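/- arXiv:alg-geom/9706002 — 3 statements merged into one kernel-verified Lean document; each statement's English description precedes it below -/
import Mathlib

section
/- Let ℓ be a prime, G a finite group of order not divisible by ℓ, V a finite-dimensional ℚ_ℓ-vector space with a linear G-action, and e : V × V → ℚ_ℓ a G-invariant non-degenerate alternating bilinear form. Let M be a G-stable ℤ_ℓ-lattice in V. Then there exists a perfect G-invariant alternating bilinear form e' : M × M → ℤ_ℓ. -/
set_option linter.unusedSectionVars false

section Abstract
open Module
variable {R : Type*} [CommRing R] [IsDomain R] [IsPrincipalIdealRing R]
  {A : Type*} [AddCommGroup A] [Module R A] [Module.Finite R A] [Module.Free R A]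
  {G : Type*} [Group G] [Fintype G]

theorem aux_proj {p : R} (hp : Irreducible p) (B : Submodule R A) (hB : ∀ a : A, p • a ∈ B) :
    ∃ P : A →ₗ[R] A, (∀ a, P a ∈ B) ∧ ∀ b ∈ B, ∃ c, P b - b = p • c := by
  classical
  have hp0 : p ≠ 0 := hp.ne_zero
  let b := Module.Free.chooseBasis R A
  have hrank : finrank R B = finrank R A := by
    apply le_antisymm (Submodule.finrank_le B)
    let i : A →ₗ[R] B := (LinearMap.lsmul R A p).codRestrict B hB
    apply LinearMap.finrank_le_finrank_of_injective (f := i)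
    intro x y hxy
    have : p • x = p • y := congrArg Subtype.val hxy
    exact smul_right_injective A hp0 this
  obtain ⟨b', a, ab', hab⟩ := Submodule.exists_smith_normal_form_of_rank_eq b hrank
  have hdvd : ∀ i, IsUnit (a i) ∨ p ∣ a i := by
    intro i
    obtain ⟨c, hc⟩ := (ab'.mem_submodule_iff').1 (hB (b' i))
    have h1 := congrArg (fun v => b'.repr v i) hc
    simp [hab, Finsupp.single_apply] at h1
    rcases hp.isUnit_or_isUnit h1 with h | h
    · right
      obtain ⟨u, hu⟩ := h
      refine ⟨(u⁻¹ : Rˣ), ?_⟩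
      rw [h1, ← hu, mul_comm, ← mul_assoc]; simp
    · exact Or.inl h
  refine ⟨b'.constr R (fun i => if IsUnit (a i) then b' i else 0), ?_, ?_⟩
  · intro x
    rw [Basis.constr_apply_fintype]
    refine Submodule.sum_mem _ fun i _ => Submodule.smul_mem _ _ ?_
    split_ifs with h
    · obtain ⟨u, hu⟩ := h
      have : b' i = (u⁻¹ : Rˣ) • ((ab' i : B) : A) := by
        rw [hab, ← hu]; simp [Units.smul_def, smul_smul]
      rw [this]
      exact Submodule.smul_mem _ _ (ab' i).2
    · exact zero_mem _
  · intro x hx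
    obtain ⟨c, rfl⟩ := (ab'.mem_submodule_iff').1 hx
    have : ∀ i, ∃ d, (b'.constr R (fun i => if IsUnit (a i) then b' i else 0)) (a i • b' i)
        - a i • b' i = p • d := by
      intro i
      rw [map_smul, Basis.constr_basis]
      split_ifs with h
      · exact ⟨0, by simp⟩
      · obtain ⟨d, hd⟩ := (hdvd i).resolve_left h
        exact ⟨-(d • b' i), by rw [hd]; simp [smul_smul]⟩
    choose d hd using this
    refine ⟨∑ i, c i • d i, ?_⟩
    rw [map_sum, ← Finset.sum_sub_distrib, Finset.smul_sum]
    refine Finset.sum_congr rfl fun i _ => ?_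
    rw [hab, map_smul, ← smul_sub, hd, smul_comm]

theorem aux_proj_equiv {p : R} (hp : Irreducible p) (hG : IsUnit (Fintype.card G : R))
    (σ : Representation R G A)
    (B : Submodule R A) (hB : ∀ a : A, p • a ∈ B) (hs : ∀ g, ∀ b ∈ B, σ g b ∈ B) :
    ∃ P : A →ₗ[R] A, (∀ a, P a ∈ B) ∧ (∀ b ∈ B, ∃ c, P b - b = p • c) ∧
      ∀ g a, P (σ g a) = σ g (P a) := by
  obtain ⟨P, h1, h2⟩ := aux_proj hp B hB
  obtain ⟨u, hu⟩ := hG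
  have key : ∀ g h : G, ∀ x, σ g (σ h x) = σ (g * h) x := fun g h x => by simp
  refine ⟨((u⁻¹ : Rˣ) : R) • ∑ g : G, (σ g).comp (P.comp (σ g⁻¹)), ?_, ?_, ?_⟩
  · intro a
    rw [LinearMap.smul_apply, LinearMap.sum_apply]
    exact Submodule.smul_mem _ _ (Submodule.sum_mem _ fun g _ => hs _ _ (h1 _))
  · intro b hb
    choose c hc using fun g => h2 (σ g⁻¹ b) (hs _ _ hb)
    refine ⟨((u⁻¹ : Rˣ) : R) • ∑ g, σ g (c g), ?_⟩
    have hb' : b = ((u⁻¹ : Rˣ) : R) • ∑ g : G, σ g (σ g⁻¹ b) := by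
      simp only [key, mul_inv_cancel, map_one, Module.End.one_apply, Finset.sum_const,
        Finset.card_univ]
      rw [← Nat.cast_smul_eq_nsmul R, ← hu, smul_smul]; simp
    have e1 : (((u⁻¹ : Rˣ) : R) • ∑ g : G, (σ g).comp (P.comp (σ g⁻¹))) b - b
        = ((u⁻¹ : Rˣ) : R) • ∑ g : G, σ g (P (σ g⁻¹ b))
          - ((u⁻¹ : Rˣ) : R) • ∑ g : G, σ g (σ g⁻¹ b) := by
      rw [← hb', LinearMap.smul_apply, LinearMap.sum_apply]; rfl
    rw [e1, ← smul_sub, ← Finset.sum_sub_distrib, smul_comm p, Finset.smul_sum (r := p)]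
    congr 1
    refine Finset.sum_congr rfl fun g _ => ?_
    rw [← map_smul, ← hc, map_sub]
  · intro g a
    rw [LinearMap.smul_apply, LinearMap.smul_apply, LinearMap.sum_apply, LinearMap.sum_apply,
      map_smul, map_sum]
    congr 1
    refine Fintype.sum_equiv (Equiv.mulLeft g⁻¹) _ _ fun h => ?_
    simp only [Equiv.coe_mulLeft, LinearMap.comp_apply, key, mul_inv_rev, inv_inv,
      mul_inv_cancel_left]

theorem aux_iso [IsLocalRing R] {p : R} (hp : Irreducible p) (hG : IsUnit (Fintype.card G : R))
    (σ : Representation R G A)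
    (B : Submodule R A) (hB : ∀ a : A, p • a ∈ B) (hs : ∀ g, ∀ b ∈ B, σ g b ∈ B) :
    ∃ T : A ≃ₗ[R] B, ∀ g a, (T (σ g a) : A) = σ g (T a) := by
  obtain ⟨Q, h1, h2, h3⟩ := aux_proj_equiv hp hG σ B hB hs
  -- improved projector
  obtain ⟨P, k1, k2, k3, k4⟩ : ∃ P : A →ₗ[R] A, (∀ a, P a ∈ B) ∧ (∀ b ∈ B, ∃ c, P b - b = p • c) ∧
      (∀ g a, P (σ g a) = σ g (P a)) ∧ ∀ a, ∃ c, P (a - P a) = p • p • c := by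
    refine ⟨(3 : R) • Q ^ 2 - (2 : R) • Q ^ 3, ?_, ?_, ?_, ?_⟩
    · intro a
      simp only [pow_succ, pow_zero, one_mul, LinearMap.sub_apply, LinearMap.smul_apply,
        Module.End.mul_apply]
      exact sub_mem (Submodule.smul_mem _ _ (h1 _)) (Submodule.smul_mem _ _ (h1 _))
    · intro b hb
      obtain ⟨c, hc⟩ := h2 b hb
      have e1 : Q b = b + p • c := by rw [← hc]; abel
      refine ⟨(3 : R) • (c + Q c) - (2 : R) • (c + Q c + Q (Q c)), ?_⟩
      simp only [pow_succ, pow_zero, one_mul, LinearMap.sub_apply, LinearMap.smul_apply,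
        Module.End.mul_apply, e1, map_add, map_smul]
      module
    · intro g a
      simp [pow_succ, h3]
    · intro a
      have e1 : ∀ a, ∃ c, Q (Q a) - Q a = p • c := fun a => h2 _ (h1 a)
      have e2 : ∀ a, ∃ c, (Q ^ 2 - Q) ((Q ^ 2 - Q) a) = p • p • c := by
        intro a
        obtain ⟨c, hc⟩ := e1 a
        obtain ⟨d, hd⟩ := e1 c
        refine ⟨d, ?_⟩
        rw [← hd]
        simp only [pow_succ, pow_zero, one_mul, LinearMap.sub_apply, 
          Module.End.mul_apply, hc, map_smul, smul_sub]
      obtain ⟨c, hc⟩ := e2 ((3 : R) • a + (4 : R) • Q a - (4 : R) • Q (Q a))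
      refine ⟨c, ?_⟩
      rw [← hc]
      simp only [pow_succ, pow_zero, one_mul, LinearMap.sub_apply, LinearMap.smul_apply,
        Module.End.mul_apply, map_sub, map_add, map_smul]
      module
  let T0 : A →ₗ[R] A := P + p • (LinearMap.id - P)
  have hT0 : ∀ a, T0 a = P a + p • (a - P a) := fun a => by simp [T0]
  have hT0B : ∀ a, T0 a ∈ B := fun a => by rw [hT0]; exact add_mem (k1 a) (hB _)
  let T : A →ₗ[R] B := T0.codRestrict B hT0B
  have hT : ∀ a, (T a : A) = P a + p • (a - P a) := hT0
  have hsurj : Function.Surjective T := by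
    rw [← LinearMap.range_eq_top, eq_top_iff]
    apply Submodule.le_of_le_smul_of_le_jacobson_bot (I := Ideal.span {p}) Module.Finite.fg_top
    · rw [IsLocalRing.jacobson_eq_maximalIdeal _ bot_ne_top, Ideal.span_le,
        Set.singleton_subset_iff]
      exact hp.not_isUnit
    · rintro b -
      have s1 : ∀ a, (⟨p • a, hB a⟩ : B) ∈ LinearMap.range T ⊔ Ideal.span {p} • ⊤ := by
        intro a
        obtain ⟨c, hc⟩ := k4 a
        have : (⟨p • a, hB a⟩ : B) = T (a - P a) +
            p • (⟨P a + P (a - P a) - p • c, sub_mem (add_mem (k1 _) (k1 _)) (hB _)⟩ : B) := by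
          ext
          simp only [Submodule.coe_add, Submodule.coe_smul, hT]
          rw [hc]; module
        rw [this]
        exact Submodule.add_mem_sup ⟨_, rfl⟩
          (Submodule.smul_mem_smul (Ideal.mem_span_singleton_self p) trivial)
      obtain ⟨c, hc⟩ := k2 b b.2
      have : b = T b + (-1 + p) • (⟨p • c, hB c⟩ : B) := by
        ext
        simp only [Submodule.coe_add, Submodule.coe_smul, hT]
        have : P (b : A) = b + p • c := by rw [← hc]; abel
        rw [this]; module
      rw [this]
      exact add_mem (Submodule.mem_sup_left ⟨_, rfl⟩) (Submodule.smul_mem _ _ (s1 c))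
  have hinj : Function.Injective T := by
    let i : A →ₗ[R] B := (LinearMap.lsmul R A p).codRestrict B hB
    apply OrzechProperty.injective_of_surjective_of_injective i T _ hsurj
    intro x y hxy
    have : p • x = p • y := congrArg Subtype.val hxy
    exact smul_right_injective A hp.ne_zero this
  refine ⟨LinearEquiv.ofBijective T ⟨hinj, hsurj⟩, fun g a => ?_⟩
  change (T (σ g a) : A) = σ g (T a : A)
  simp [hT, k3]

theorem aux_bij [IsLocalRing R] {p : R} (hmax : IsLocalRing.maximalIdeal R = Ideal.span {p})
    (f : A →ₗ[R] A →ₗ[R] R) (hf : ∀ x, (∀ y, p ∣ f x y) → ∃ c, x = p • c) :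
    Function.Bijective f := by
  classical
  let b := Module.Free.chooseBasis R A
  let M := LinearMap.toMatrix b b.dualBasis f
  have hM : ∀ i j, M i j = f (b j) (b i) := by
    intro i j
    simp [M, LinearMap.toMatrix_apply]
  have hu : IsUnit M.det := by
    by_contra hdet
    have : (M.map (IsLocalRing.residue R)).det = 0 := by
      rw [← RingHom.mapMatrix_apply, ← RingHom.map_det]
      rw [IsLocalRing.residue_eq_zero_iff]; exact hdet
    obtain ⟨v, hv0, hv⟩ := Matrix.exists_mulVec_eq_zero_iff.2 this
    choose w hw using fun i => IsLocalRing.residue_surjective (v i)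
    have := hf (∑ i, w i • b i) ?_
    · obtain ⟨c, hc⟩ := this
      apply hv0
      ext i
      rw [← hw, Pi.zero_apply, IsLocalRing.residue_eq_zero_iff, hmax, Ideal.mem_span_singleton]
      refine ⟨b.repr c i, ?_⟩
      have := congrArg (fun x => b.repr x i) hc
      simpa [Finsupp.single_apply] using this
    · have : ∀ j, p ∣ f (∑ i, w i • b i) (b j) := by
        intro j
        rw [← Ideal.mem_span_singleton, ← hmax, ← IsLocalRing.residue_eq_zero_iff]
        have := congrFun hv j
        simp only [Matrix.mulVec, dotProduct, Matrix.map_apply, Pi.zero_apply, hM] at this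
        rw [← this]
        simp [hw, mul_comm]
      intro y
      rw [← b.sum_repr y, map_sum]
      exact Finset.dvd_sum fun i _ => by rw [map_smul]; exact Dvd.dvd.mul_left (this i) _
  have := (LinearEquiv.ofIsUnitDet (f := f) (v := b) (v' := b.dualBasis) hu).bijective
  exact this

end Abstract

section Lattice
open Module
variable {R : Type*} [CommRing R] [IsDomain R] [IsDiscreteValuationRing R]
  {K : Type*} [Field K] [Algebra R K] [IsFractionRing R K]
  {V : Type*} [AddCommGroup V] [Module K V] [Module R V] [IsScalarTower R K V]
  {G : Type*} [Group G] [Fintype G]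

/-- The lattice `L` carries a perfect invariant alternating form. -/
def HasPerf (ρ : Representation K G V) (L : Submodule R V) : Prop :=
  ∃ f : L →ₗ[R] L →ₗ[R] R, (∀ x, f x x = 0) ∧
    (∀ g (x y x' y' : L), (x' : V) = ρ g x → (y' : V) = ρ g y → f x' y' = f x y) ∧
    Function.Bijective f

/-- The representation on a stable lattice. -/
def latRep (ρ : Representation K G V) (L : Submodule R V) (hL : ∀ g, ∀ x ∈ L, ρ g x ∈ L) :
    Representation R G L where
  toFun g := ((ρ g).restrictScalars R).restrict (hL g)
  map_one' := by ext x; simp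
  map_mul' g h := by
    ext x
    change ρ (g * h) (x : V) = ρ g (ρ h x)
    simp

theorem latRep_apply (ρ : Representation K G V) (L : Submodule R V)
    (hL : ∀ g, ∀ x ∈ L, ρ g x ∈ L) (g : G) (x : L) : (latRep ρ L hL g x : V) = ρ g x := rfl

theorem perf_step {p : R} (hp : Irreducible p) (hG : IsUnit (Fintype.card G : R))
    (ρ : Representation K G V) (L L' : Submodule R V)
    [Module.Finite R L'] [Module.Free R L']
    (hL : ∀ g, ∀ x ∈ L, ρ g x ∈ L) (hL' : ∀ g, ∀ x ∈ L', ρ g x ∈ L')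
    (hle : L ≤ L') (hpL : ∀ x ∈ L', p • x ∈ L) (h : HasPerf ρ L') : HasPerf ρ L := by
  obtain ⟨T, hT⟩ := aux_iso hp hG (latRep ρ L' hL') (L.comap L'.subtype)
    (fun a => hpL a a.2) (fun g b hb => hL g _ hb)
  let S : L ≃ₗ[R] L' := (T.trans (Submodule.comapSubtypeEquivOfLe hle)).symm
  have hTS : ∀ x : L, ((T (S x) : L') : V) = x := by
    intro x
    have := (T.trans (Submodule.comapSubtypeEquivOfLe hle)).apply_symm_apply x
    exact congrArg Subtype.val this
  have hS : ∀ g (x x' : L), (x' : V) = ρ g x → S x' = latRep ρ L' hL' g (S x) := by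
    intro g x x' hx
    apply T.injective
    ext
    rw [hTS, hT, latRep_apply, hTS, hx]
  obtain ⟨f, f1, f2, f3⟩ := h
  refine ⟨S.dualMap.toLinearMap ∘ₗ f ∘ₗ S.toLinearMap, ?_, ?_, ?_⟩
  · intro x; exact f1 _
  · intro g x y x' y' hx hy
    change f (S x') (S y') = f (S x) (S y)
    apply f2 g
    · rw [hS g x x' hx, latRep_apply]
    · rw [hS g y y' hy, latRep_apply]
  · exact S.dualMap.bijective.comp (f3.comp S.bijective)

theorem perf_base {p : R} (hp : Irreducible p) (hG : IsUnit (Fintype.card G : R))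
    (ρ : Representation K G V) (e : LinearMap.BilinForm K V)
    (halt : ∀ x, e x x = 0) (hinv : ∀ g x y, e (ρ g x) (ρ g y) = e x y)
    (L : Submodule R V) [Module.Finite R L] [Module.Free R L]
    (hL : ∀ g, ∀ x ∈ L, ρ g x ∈ L) (hint : L ≤ e.dualSubmodule L)
    (hdd : ∀ x, (∀ u ∈ e.dualSubmodule L, e x u ∈ (1 : Submodule R K)) → x ∈ L)
    (hpD : ∀ u ∈ e.dualSubmodule L, p • u ∈ L) : HasPerf ρ L := by
  have hinj : Function.Injective (algebraMap R K) := IsFractionRing.injective R K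
  have hpK : algebraMap R K p ≠ 0 := by
    rw [Ne, map_eq_zero_iff _ hinj]; exact hp.ne_zero
  have hanti : ∀ x y, e x y = - e y x := by
    intro x y
    have := halt (x + y)
    simp [halt] at this
    exact eq_neg_of_add_eq_zero_left this
  have hsmulL : ∀ (r : R) x y, e (r • x) y = algebraMap R K r * e x y := by
    intro r x y; rw [← algebraMap_smul K r x, map_smul]; rfl
  have hsmulR : ∀ (r : R) x y, e x (r • y) = algebraMap R K r * e x y := by
    intro r x y; rw [← algebraMap_smul K r y, map_smul]; rfl
  set D := e.dualSubmodule L with hD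
  have hDs : ∀ g, ∀ x ∈ D, ρ g x ∈ D := by
    intro g x hx y hy
    have := hx _ (hL g⁻¹ y hy)
    rw [← hinv g] at this
    simpa using this
  let N : Submodule R L := (D.map (LinearMap.lsmul R V p)).comap L.subtype
  have hNmem : ∀ x : L, x ∈ N ↔ ∃ u ∈ D, p • u = x := fun x => Iff.rfl
  obtain ⟨P, h1, h2, h3⟩ := aux_proj_equiv hp hG (latRep ρ L hL) N
    (fun a => (hNmem _).2 ⟨a, hint a.2, rfl⟩) (by
      intro g b hb
      obtain ⟨u, hu, hub⟩ := (hNmem _).1 hb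
      refine (hNmem _).2 ⟨ρ g u, hDs g u hu, ?_⟩
      rw [latRep_apply, ← hub]
      exact ((ρ g).restrictScalars R).map_smul p u |>.symm)
  let F : L → L → K := fun x y => e x y + (algebraMap R K p)⁻¹ * e (P x) (P y)
  have hF : ∀ x y, ∃ r : R, algebraMap R K r = F x y := by
    intro x y
    obtain ⟨u, hu, hux⟩ := (hNmem _).1 (h1 x)
    obtain ⟨r, hr⟩ := Submodule.mem_one.1 (hint x.2 y y.2)
    obtain ⟨s, hs⟩ := Submodule.mem_one.1 (hu (P y) (P y).2)
    refine ⟨r + s, ?_⟩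
    simp only [F]
    rw [← hux, hsmulL, map_add, hr, hs]
    field_simp
  choose φ hφ using hF
  let f : L →ₗ[R] L →ₗ[R] R := LinearMap.mk₂ R φ
    (fun x x' y => hinj (by simp [hφ, F]; ring))
    (fun r x y => hinj (by simp [hφ, F, Algebra.smul_def]; ring))
    (fun x y y' => hinj (by simp [hφ, F]; ring))
    (fun r x y => hinj (by simp [hφ, F, hsmulR]; ring))
  have hf : ∀ x y, algebraMap R K (f x y) = e x y + (algebraMap R K p)⁻¹ * e (P x) (P y) := hφ
  refine ⟨f, ?_, ?_, ?_⟩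
  · intro x
    apply hinj
    rw [hf, halt, halt]; simp
  · intro g x y x' y' hx hy
    have ex : x' = latRep ρ L hL g x := Subtype.ext hx
    have ey : y' = latRep ρ L hL g y := Subtype.ext hy
    apply hinj
    rw [hf, hf, ex, ey, h3, h3]
    simp only [latRep_apply, hinv]
  · apply aux_bij (p := p) hp.maximalIdeal_eq
    intro x hx
    have hx' : ∀ y : L, ∃ r : R, e x y + (algebraMap R K p)⁻¹ * e (P x) (P y)
        = algebraMap R K p * algebraMap R K r := by
      intro y
      obtain ⟨r, hr⟩ := hx y
      exact ⟨r, by rw [← hf, hr, map_mul]⟩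
    obtain ⟨v, hv, hvx⟩ := (hNmem _).1 (h1 x)
    -- `P x ∈ p L`
    have hvL : v ∈ L := by
      apply hdd
      intro u hu
      have hyL : p • u ∈ L := hpD u hu
      have hyN : (⟨p • u, hyL⟩ : L) ∈ N := (hNmem _).2 ⟨u, hu, rfl⟩
      obtain ⟨c, hc⟩ := h2 _ hyN
      have hc' : (P ⟨p • u, hyL⟩ : V) = p • u + p • (c : V) := by
        have := congrArg (Subtype.val) hc
        simp only [Submodule.coe_sub, Submodule.coe_smul] at this
        rw [← this]; abel
      obtain ⟨r, hr⟩ := hx' ⟨p • u, hyL⟩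
      rw [← hvx, hc', hsmulL, hsmulR, map_add, hsmulR, hsmulR] at hr
      obtain ⟨s, hs⟩ := Submodule.mem_one.1 (hu x x.2)
      obtain ⟨t, ht⟩ := Submodule.mem_one.1 (hv c c.2)
      rw [hanti x u, ← hs, ← ht] at hr
      refine Submodule.mem_one.2 ⟨r - t + s, ?_⟩
      simp only [map_add, map_sub]
      field_simp at hr
      linear_combination -hr
    -- `x ∈ N`
    have hxN : x ∈ N := by
      refine (hNmem _).2 ⟨(algebraMap R K p)⁻¹ • (x : V), ?_, ?_⟩
      · intro y hy
        obtain ⟨r, hr⟩ := hx' ⟨y, hy⟩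
        obtain ⟨w, hw, hwy⟩ := (hNmem _).1 (h1 ⟨y, hy⟩)
        obtain ⟨s, hs⟩ := Submodule.mem_one.1 (hw v hvL)
        rw [← hvx, ← hwy, hsmulL, hsmulR, hanti v w, ← hs] at hr
        refine Submodule.mem_one.2 ⟨r + s, ?_⟩
        simp only [map_add, map_smul, LinearMap.smul_apply, smul_eq_mul]
        field_simp at hr ⊢
        linear_combination -hr
      · rw [← algebraMap_smul K p, smul_smul, mul_inv_cancel₀ hpK, one_smul]
    obtain ⟨c, hc⟩ := h2 x hxN
    refine ⟨⟨v, hvL⟩ - c, ?_⟩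
    rw [smul_sub, ← hc]
    have : P x = p • (⟨v, hvL⟩ : L) := Subtype.ext hvx.symm
    rw [this]; abel

theorem span_extend {ι : Type*} (L : Submodule R V) [Submodule.IsLattice K L] (b : Basis ι R L) :
    Submodule.span R (Set.range (b.extendOfIsLattice K)) = L := by
  have : (Set.range (b.extendOfIsLattice K)) = L.subtype '' Set.range b := by
    rw [← Set.range_comp]; congr 1; ext i; simp
  rw [this, ← Submodule.map_span, b.span_eq, Submodule.map_top, Submodule.range_subtype]

theorem perf_induct [FiniteDimensional K V]
    {p : R} (hp : Irreducible p) (hG : IsUnit (Fintype.card G : R))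
    (ρ : Representation K G V) (e : LinearMap.BilinForm K V) (he : e.Nondegenerate)
    (halt : ∀ x, e x x = 0) (hinv : ∀ g x y, e (ρ g x) (ρ g y) = e x y) (k : ℕ) :
    ∀ (L : Submodule R V) [Submodule.IsLattice K L]
    (_ : ∀ g, ∀ x ∈ L, ρ g x ∈ L) (_ : L ≤ e.dualSubmodule L)
    (_ : ∀ u ∈ e.dualSubmodule L, p ^ (k + 1) • u ∈ L), HasPerf ρ L := by
  have hinj : Function.Injective (algebraMap R K) := IsFractionRing.injective R K
  have hpK : algebraMap R K p ≠ 0 := by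
    rw [Ne, map_eq_zero_iff _ hinj]; exact hp.ne_zero
  have hanti : ∀ x y, e x y = - e y x := by
    intro x y
    have := halt (x + y)
    simp [halt] at this
    exact eq_neg_of_add_eq_zero_left this
  have hsmulL : ∀ (r : R) x y, e (r • x) y = algebraMap R K r * e x y := by
    intro r x y; rw [← algebraMap_smul K r x, map_smul]; rfl
  have hsmulR : ∀ (r : R) x y, e x (r • y) = algebraMap R K r * e x y := by
    intro r x y; rw [← algebraMap_smul K r y, map_smul]; rfl
  induction k with
  | zero =>
    intro L _ hL hint hD
    have : Module.Free R L := Submodule.IsLattice.free K L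
    refine perf_base hp hG ρ e halt hinv L hL hint ?_ (by simpa using hD)
    intro x hx
    let b := Module.Free.chooseBasis R L
    have h1 := LinearMap.BilinForm.dualSubmodule_flip_dualSubmodule_of_basis (R := R) (B := e) he
      (b.extendOfIsLattice K)
    rw [span_extend] at h1
    rw [← h1]
    intro u hu
    have := neg_mem (hx u hu)
    rw [← hanti] at this
    exact this
  | succ k ih =>
    intro L _ hL hint hD
    set D := e.dualSubmodule L with hDdef
    let L' : Submodule R V := L ⊔ D.map (LinearMap.lsmul R V (p ^ (k + 1)))
    have hmem : ∀ x, x ∈ L' ↔ ∃ l ∈ L, ∃ u ∈ D, l + p ^ (k + 1) • u = x := by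
      intro x
      simp [L', Submodule.mem_sup]
    have hle : L ≤ L' := le_sup_left
    have hDs : ∀ g, ∀ x ∈ D, ρ g x ∈ D := by
      intro g x hx y hy
      have := hx _ (hL g⁻¹ y hy)
      rw [← hinv g] at this
      simpa using this
    have hL' : ∀ g, ∀ x ∈ L', ρ g x ∈ L' := by
      intro g x hx
      obtain ⟨l, hl, u, hu, rfl⟩ := (hmem _).1 hx
      refine (hmem _).2 ⟨ρ g l, hL g l hl, ρ g u, hDs g u hu, ?_⟩
      rw [map_add]
      congr 1
      exact ((ρ g).restrictScalars R).map_smul _ u |>.symm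
    have hpL : ∀ x ∈ L', p • x ∈ L := by
      intro x hx
      obtain ⟨l, hl, u, hu, rfl⟩ := (hmem _).1 hx
      rw [smul_add, smul_smul, ← pow_succ']
      exact add_mem (L.smul_mem _ hl) (hD u hu)
    have hfg : L'.FG := by
      let i : L' →ₗ[R] L := ((LinearMap.lsmul R V p).comp L'.subtype).codRestrict L
        (fun x => hpL x x.2)
      have hi : Function.Injective i := by
        intro x y hxy
        have h1 : p • (x : V) = p • (y : V) := congrArg Subtype.val hxy
        rw [← algebraMap_smul K p, ← algebraMap_smul K p] at h1
        exact Subtype.ext (smul_right_injective V hpK h1)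
      have : Module.Finite R L' := Module.Finite.of_injective i hi
      exact Module.Finite.iff_fg.1 this
    have : Submodule.IsLattice K L' := Submodule.IsLattice.of_le_of_isLattice_of_fg K hle hfg
    have : Module.Free R L' := Submodule.IsLattice.free K L'
    refine perf_step hp hG ρ L L' hL hL' hle hpL (ih L' hL' ?_ ?_)
    · intro x hx y hy
      obtain ⟨l, hl, u, hu, rfl⟩ := (hmem _).1 hx
      obtain ⟨m, hm, w, hw, rfl⟩ := (hmem _).1 hy
      obtain ⟨r1, hr1⟩ := Submodule.mem_one.1 (hint hl m hm)
      obtain ⟨r2, hr2⟩ := Submodule.mem_one.1 (hu m hm)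
      obtain ⟨r3, hr3⟩ := Submodule.mem_one.1 (hw l hl)
      obtain ⟨r4, hr4⟩ := Submodule.mem_one.1 (hw _ (hD u hu))
      rw [hanti, hsmulL] at hr4
      refine Submodule.mem_one.2 ⟨r1 + p ^ (k + 1) * r2 - p ^ (k + 1) * r3 - p ^ k * r4, ?_⟩
      simp only [map_add, map_sub, map_mul, hr1, hr2, hr3, hr4, LinearMap.add_apply, hsmulL,
        hsmulR, hanti w, map_pow]
      ring
    · intro u hu
      have : u ∈ D := fun y hy => hu y (hle hy)
      exact (hmem _).2 ⟨0, zero_mem _, u, this, by simp⟩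

theorem perf_main [FiniteDimensional K V] (hG : IsUnit (Fintype.card G : R))
    (ρ : Representation K G V) (e : LinearMap.BilinForm K V)
    (hnd : ∀ x, (∀ y, e x y = 0) → x = 0)
    (halt : ∀ x, e x x = 0) (hinv : ∀ g x y, e (ρ g x) (ρ g y) = e x y)
    (L : Submodule R V) [Submodule.IsLattice K L] (hL : ∀ g, ∀ x ∈ L, ρ g x ∈ L) :
    HasPerf ρ L := by
  classical
  obtain ⟨p, hp⟩ := IsDiscreteValuationRing.exists_irreducible R
  have hinj : Function.Injective (algebraMap R K) := IsFractionRing.injective R K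
  have hfree : Module.Free R L := Submodule.IsLattice.free K L
  obtain ⟨m, c, hc⟩ : ∃ (m : ℕ) (c : Basis (Fin m) K V),
      Submodule.span R (Set.range c) = L :=
    ⟨_, _, span_extend L (Module.finBasis R L)⟩
  have hcL : ∀ i, c i ∈ L := fun i => by rw [← hc]; exact Submodule.subset_span ⟨i, rfl⟩
  obtain ⟨s, hs⟩ := IsLocalization.exist_integer_multiples_of_finite (nonZeroDivisors R)
    (fun ij : _ × _ => e (c ij.1) (c ij.2))
  have hs0 : algebraMap R K s ≠ 0 := by
    rw [Ne, map_eq_zero_iff _ hinj]; exact nonZeroDivisors.coe_ne_zero s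
  let e' : LinearMap.BilinForm K V := algebraMap R K s • e
  have he' : ∀ x y, e' x y = algebraMap R K s * e x y := fun x y => rfl
  have halt' : ∀ x, e' x x = 0 := fun x => by rw [he', halt, mul_zero]
  have hinv' : ∀ g x y, e' (ρ g x) (ρ g y) = e' x y := fun g x y => by rw [he', he', hinv]
  have hanti : ∀ x y, e' x y = - e' y x := by
    intro x y
    have := halt' (x + y)
    simp [halt'] at this
    exact eq_neg_of_add_eq_zero_left this
  have hnd' : e'.Nondegenerate := by
    have h1 : ∀ x, (∀ y, e' x y = 0) → x = 0 := fun x hx =>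
      hnd x fun y => (mul_eq_zero.1 (hx y)).resolve_left hs0
    refine ⟨h1, fun x hx => h1 x fun y => ?_⟩
    rw [hanti, hx, neg_zero]
  have hint : L ≤ e'.dualSubmodule L := by
    intro x hx y hy
    rw [← hc] at hx hy
    obtain ⟨f, rfl⟩ := (Submodule.mem_span_range_iff_exists_fun _).mp hx
    obtain ⟨h, rfl⟩ := (Submodule.mem_span_range_iff_exists_fun _).mp hy
    rw [map_sum]
    refine sum_mem fun j _ => ?_
    rw [map_sum, LinearMap.sum_apply]
    refine sum_mem fun i _ => ?_
    obtain ⟨t, ht⟩ := hs (i, j)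
    refine Submodule.mem_one.2 ⟨f i * h j * t, ?_⟩
    rw [← algebraMap_smul K (f i), ← algebraMap_smul K (h j), map_smul, map_smul,
      LinearMap.smul_apply, he', map_mul, map_mul, ht, smul_eq_mul, smul_eq_mul, Algebra.smul_def]
    ring
  have hD := LinearMap.BilinForm.dualSubmodule_span_of_basis (R := R) e' hnd' c
  rw [hc] at hD
  set d := e'.dualBasis hnd' c
  obtain ⟨t, ht⟩ := IsLocalization.exist_integer_multiples_of_finite (nonZeroDivisors R)
    (fun ij : _ × _ => c.repr (d ij.1) ij.2)
  have htD : ∀ u ∈ e'.dualSubmodule L, (t : R) • u ∈ L := by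
    rw [hD]
    have : Submodule.span R (Set.range d) ≤ L.comap (LinearMap.lsmul R V (t : R)) := by
      rw [Submodule.span_le]
      rintro _ ⟨i, rfl⟩
      change (t : R) • d i ∈ L
      rw [← c.sum_repr (d i), Finset.smul_sum]
      refine Submodule.sum_mem _ fun j _ => ?_
      obtain ⟨r, hr⟩ := ht (i, j)
      rw [← smul_assoc]
      erw [← hr]
      rw [algebraMap_smul]
      exact L.smul_mem _ (hcL j)
    exact this
  obtain ⟨n, u, hu⟩ := IsDiscreteValuationRing.eq_unit_mul_pow_irreducible
    (nonZeroDivisors.coe_ne_zero t) hp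
  refine perf_induct hp hG ρ e' hnd' halt' hinv' n L hL hint ?_
  intro x hx
  have h1 := L.smul_mem (p * (u⁻¹ : Rˣ)) (htD x hx)
  rw [hu, smul_smul] at h1
  convert h1 using 2
  rw [pow_succ, mul_assoc, ← mul_assoc ((u⁻¹ : Rˣ) : R), Units.inv_mul, one_mul, mul_comm]

end Lattice

/-- Proposition: if `ℓ ∤ #G`, `V` is a finite-dimensional `ℚ_ℓ`-vector space with a `G`-action,
`e` is a `G`-invariant non-degenerate alternating form on `V`, and `M` is a `G`-stable
`ℤ_ℓ`-lattice in `V`, then `M` carries a perfect `G`-invariant alternating `ℤ_ℓ`-valued form. -/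
theorem exists_perfect_invariant_alternating_form_on_lattice
    (ℓ : ℕ) [Fact (Nat.Prime ℓ)] (G : Type*) [Group G] [Fintype G]
    (hG : ¬ (ℓ ∣ Fintype.card G))
    (V : Type*) [AddCommGroup V] [Module ℚ_[ℓ] V] [FiniteDimensional ℚ_[ℓ] V]
    [Module ℤ_[ℓ] V] [IsScalarTower ℤ_[ℓ] ℚ_[ℓ] V]
    (ρ : Representation ℚ_[ℓ] G V)
    (e : V →ₗ[ℚ_[ℓ]] V →ₗ[ℚ_[ℓ]] ℚ_[ℓ])
    (halt : ∀ x : V, e x x = 0)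
    (hnd : ∀ x : V, (∀ y : V, e x y = 0) → x = 0)
    (hinv : ∀ (g : G) (x y : V), e (ρ g x) (ρ g y) = e x y)
    (M : Submodule ℤ_[ℓ] V) [Module.Finite ℤ_[ℓ] M] [Module.Free ℤ_[ℓ] M]
    (hspan : Submodule.span ℚ_[ℓ] (M : Set V) = ⊤)
    (hstab : ∀ (g : G) (x : V), x ∈ M → ρ g x ∈ M) :
    ∃ e' : M →ₗ[ℤ_[ℓ]] M →ₗ[ℤ_[ℓ]] ℤ_[ℓ],
      (∀ x : M, e' x x = 0) ∧
      (∀ (g : G) (x y : M),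
        e' ⟨ρ g (x : V), hstab g x x.2⟩ ⟨ρ g (y : V), hstab g y y.2⟩ = e' x y) ∧
      Function.Bijective e' := by
  have hunit : IsUnit (Fintype.card G : ℤ_[ℓ]) := by
    rw [PadicInt.isUnit_iff]
    rw [PadicInt.norm_natCast_eq_one_iff]
    exact (Nat.Prime.coprime_iff_not_dvd Fact.out).2 hG
  have hlat : Submodule.IsLattice ℚ_[ℓ] M :=
    ⟨Module.Finite.iff_fg.1 inferInstance, hspan⟩
  obtain ⟨f, f1, f2, f3⟩ := perf_main hunit ρ e hnd halt hinv M hstab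
  exact ⟨f, f1, fun g x y => f2 g x y _ _ rfl rfl, f3⟩
end

section
/- Let ℓ be a prime, G a finite group of order not divisible by ℓ, V a finite-dimensional ℚ_ℓ-vector space with a linear G-action, and e : V × V → ℚ_ℓ a G-invariant non-degenerate symmetric bilinear form. Let M be a G-stable ℤ_ℓ-lattice in V. Then there exists a perfect G-invariant symmetric bilinear form e' : M × M → ℤ_ℓ. -/
open scoped Matrix
section helpers
variable {R : Type*} [CommRing R] {n : Type*} [Fintype n] [DecidableEq n]

theorem aux_geninv {k : Type*} [Field k] (S : Matrix n n k) : ∃ T : Matrix n n k, S * T * S = S := by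
  set f := Matrix.toLin' S with hf
  obtain ⟨g, hg⟩ := f.rangeRestrict.exists_rightInverse_of_surjective f.range_rangeRestrict
  obtain ⟨q, hq⟩ := (LinearMap.range f).subtype.exists_leftInverse_of_injective
    (Submodule.ker_subtype _)
  refine ⟨LinearMap.toMatrix' (g ∘ₗ q), ?_⟩
  apply Matrix.toLin'.injective
  rw [Matrix.toLin'_mul, Matrix.toLin'_mul, Matrix.toLin'_toMatrix', ← hf]
  refine LinearMap.ext fun x => ?_
  have h1 : q (f x) = f.rangeRestrict x := by
    have := LinearMap.congr_fun hq (f.rangeRestrict x)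
    simpa using this
  have h3 := congrArg Subtype.val (LinearMap.congr_fun hg (f.rangeRestrict x))
  simp only [LinearMap.comp_apply, h1]
  exact h3

theorem aux_det_mod [IsLocalRing R] {p : R} (hp : IsLocalRing.maximalIdeal R = Ideal.span {p})
    (A B W : Matrix n n R) (h : A = B + p • W) : IsUnit A.det ↔ IsUnit B.det := by
  have hp0 : IsLocalRing.residue R p = 0 := by
    rw [IsLocalRing.residue_eq_zero_iff, hp]; exact Ideal.mem_span_singleton_self p
  rw [← isUnit_map_iff (IsLocalRing.residue R) A.det, ← isUnit_map_iff (IsLocalRing.residue R) B.det,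
    RingHom.map_det, RingHom.map_det, h]
  have : (IsLocalRing.residue R).mapMatrix (B + p • W) = (IsLocalRing.residue R).mapMatrix B := by
    ext i j
    simp [hp0]
  rw [this]

theorem aux_geninv_lift [IsLocalRing R] {p : R}
    (hp : IsLocalRing.maximalIdeal R = Ideal.span {p}) (S : Matrix n n R) (hS : Sᵀ = S) :
    ∃ T X : Matrix n n R, Tᵀ = T ∧ S * T * S = S + p • X := by
  obtain ⟨t, ht⟩ := aux_geninv ((IsLocalRing.residue R).mapMatrix S)
  choose T0 hT0 using fun i j => IsLocalRing.residue_surjective (R := R) (t i j)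
  have hT : (IsLocalRing.residue R).mapMatrix (Matrix.of T0) = t := by
    ext i j; simp [hT0]
  have key : ∀ i j, ∃ x, (S * Matrix.of T0 * S) i j = S i j + p * x := by
    intro i j
    have h : (IsLocalRing.residue R).mapMatrix (S * Matrix.of T0 * S) =
      (IsLocalRing.residue R).mapMatrix S := by rw [map_mul, map_mul, hT, ht]
    have h' := congrFun (congrFun h i) j
    simp only [RingHom.mapMatrix_apply, Matrix.map_apply] at h'
    rw [← sub_eq_zero, ← map_sub, IsLocalRing.residue_eq_zero_iff, hp,
      Ideal.mem_span_singleton] at h'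
    obtain ⟨x, hx⟩ := h'
    exact ⟨x, by rw [← hx]; ring⟩
  choose X hX using key
  set T := Matrix.of T0
  have h1 : S * T * S = S + p • Matrix.of X := by
    ext i j; simp [hX]
  have h2 : S * Tᵀ * S = S + p • (Matrix.of X)ᵀ := by
    have := congrArg Matrix.transpose h1
    rwa [Matrix.transpose_mul, Matrix.transpose_mul, Matrix.transpose_add, Matrix.transpose_smul,
      hS, ← Matrix.mul_assoc] at this
  refine ⟨T * S * Tᵀ, (Matrix.of X)ᵀ + Matrix.of X * Tᵀ * S, ?_, ?_⟩
  · simp [hS, Matrix.mul_assoc]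
  · calc S * (T * S * Tᵀ) * S = (S * T * S) * Tᵀ * S := by noncomm_ring
      _ = _ := by
        rw [h1, add_mul, add_mul, h2]
        simp only [Matrix.smul_mul, smul_add]
        abel

theorem aux_avg {G : Type*} [Group G] [Fintype G] (A : G →* Matrix n n R)
    (hG : IsUnit (Fintype.card G : R)) {p : R}
    (S T X : Matrix n n R) (hT : Tᵀ = T) (hX : S * T * S = S + p • X)
    (hA : ∀ g, (A g)ᵀ * S * A g = S) :
    ∃ T' X' : Matrix n n R, T'ᵀ = T' ∧ S * T' * S = S + p • X' ∧
      ∀ g, A g * T' * (A g)ᵀ = T' := by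
  obtain ⟨u, hu⟩ := hG.exists_left_inv
  have hinv : ∀ g, A g * A g⁻¹ = 1 := fun g => by rw [← map_mul]; simp
  have hinv' : ∀ g, (A g⁻¹)ᵀ * (A g)ᵀ = 1 := fun g => by
    rw [← Matrix.transpose_mul, hinv]; simp
  have hSA : ∀ g, S * A g = (A g⁻¹)ᵀ * S := fun g => by
    conv_rhs => rw [← hA g, ← Matrix.mul_assoc, ← Matrix.mul_assoc, hinv', Matrix.one_mul]
  have hAS : ∀ g, (A g)ᵀ * S = S * A g⁻¹ := fun g => by
    conv_rhs => rw [← hA g, Matrix.mul_assoc, hinv, Matrix.mul_one]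
  refine ⟨u • ∑ g, A g * T * (A g)ᵀ, u • ∑ g, (A g⁻¹)ᵀ * X * A g⁻¹, ?_, ?_, ?_⟩
  · simp [Matrix.transpose_sum, hT, Matrix.mul_assoc]
  · have : ∀ g, S * (A g * T * (A g)ᵀ) * S = S + p • ((A g⁻¹)ᵀ * X * A g⁻¹) := fun g => by
      calc S * (A g * T * (A g)ᵀ) * S = (S * A g) * T * ((A g)ᵀ * S) := by noncomm_ring
        _ = (A g⁻¹)ᵀ * (S * T * S) * A g⁻¹ := by rw [hSA g, hAS g]; simp only [Matrix.mul_assoc]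
        _ = _ := by rw [hX, mul_add, add_mul, hA]; simp only [Matrix.mul_smul, Matrix.smul_mul]
    simp only [Matrix.mul_smul, Matrix.smul_mul, Finset.mul_sum, Finset.sum_mul, this]
    rw [Finset.sum_add_distrib, smul_add]
    congr 1
    · simp only [Finset.sum_const, Finset.card_univ]
      rw [← Nat.cast_smul_eq_nsmul R, smul_smul, hu, one_smul]
    · rw [← Finset.smul_sum, smul_comm]
  · intro h
    simp only [Matrix.mul_smul, Matrix.smul_mul, Finset.mul_sum, Finset.sum_mul]
    congr 1
    refine Fintype.sum_equiv (Equiv.mulLeft h) _ _ fun g => ?_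
    simp [Matrix.mul_assoc]

theorem aux_step [IsDomain R] [IsLocalRing R] {p : R} (hp0 : p ≠ 0)
    (hp : IsLocalRing.maximalIdeal R = Ideal.span {p})
    {G : Type*} [Group G] [Fintype G] (A : G →* Matrix n n R)
    (hG : IsUnit (Fintype.card G : R)) 
    (S : Matrix n n R) (hS : Sᵀ = S) (hA : ∀ g, (A g)ᵀ * S * A g = S)
    (hdet : S.det ≠ 0) (hu : ¬ IsUnit S.det) :
    ∃ S' : Matrix n n R, S'ᵀ = S' ∧ (∀ g, (A g)ᵀ * S' * A g = S') ∧
      S'.det ≠ 0 ∧ DvdNotUnit S'.det S.det := by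
  obtain ⟨T1, X1, hT1, hX1⟩ := aux_geninv_lift hp S hS
  obtain ⟨T, X, hT, hX, hTA⟩ := aux_avg A hG S T1 X1 hT1 hX1 hA
  obtain ⟨Q, hQ⟩ : ∃ Q, Q = T * S := ⟨_, rfl⟩
  have hSQ : S * Q = S + p • X := by rw [hQ, ← Matrix.mul_assoc, hX]
  have hQQ : Q * Q = Q + p • (T * X) := by
    conv_lhs => enter [1]; rw [hQ]
    rw [Matrix.mul_assoc, hSQ, mul_add, ← hQ]; simp
  have hSQt : (S * Q)ᵀ = S * Q := by rw [hQ]; simp [hS, hT, Matrix.mul_assoc]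
  have hQt : Qᵀ * S = S * Q := by rw [← hSQt]; simp [hS]
  have hAQ : ∀ g, Q * A g = A g * Q := fun g => by
    have h1 : A g * A g⁻¹ = 1 := by rw [← map_mul]; simp
    rw [hQ]
    calc T * S * A g = A g * T * ((A g)ᵀ * S * A g) := by
          conv_lhs => rw [← hTA g]
          noncomm_ring
      _ = _ := by rw [hA, Matrix.mul_assoc]
  obtain ⟨Y, hY⟩ : ∃ Y, Y = T * X := ⟨_, rfl⟩
  rw [← hY] at hQQ
  have hYQ : Y * Q = Q * Y := by
    have : p • (Y * Q) = p • (Q * Y) := by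
      rw [← Matrix.smul_mul, ← Matrix.mul_smul, ← sub_eq_iff_eq_add'.2 hQQ]; noncomm_ring
    exact smul_right_injective _ hp0 this
  obtain ⟨P, hP⟩ : ∃ P, P = 3 * Q * Q - 2 * Q * Q * Q := ⟨_, rfl⟩
  have hSP : S * (1 - P) = p • (- X * (1 - Q) * (1 + 2 * Q)) := by
    calc S * (1 - P) = (S - S * Q) * (1 - Q) * (1 + 2 * Q) := by rw [hP]; noncomm_ring
      _ = _ := by rw [hSQ]; simp
  obtain ⟨Z, hZ⟩ : ∃ Z, P * (1 - P) = p • p • Z := by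
    refine ⟨Y * Y * (3 - 2 * Q) * (1 + 2 * Q), ?_⟩
    calc P * (1 - P) = (Q * Q - Q) * (Q * Q - Q) * (3 - 2 * Q) * (1 + 2 * Q) := by
          rw [hP]; noncomm_ring
      _ = _ := by rw [sub_eq_iff_eq_add'.2 hQQ]; simp
  obtain ⟨S', hS'⟩ : ∃ S', S' = S * P + (- X * (1 - Q) * (1 + 2 * Q)) := ⟨_, rfl⟩
  have hpS' : p • S' = S * (p • P + (1 - P)) := by
    rw [hS', smul_add, ← hSP, mul_add, Matrix.mul_smul]
  have hQQS : Qᵀ * Qᵀ * S = S * Q * Q := by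
    rw [Matrix.mul_assoc, hQt, ← Matrix.mul_assoc, hQt]
  have hQQQS : Qᵀ * Qᵀ * Qᵀ * S = S * Q * Q * Q := by
    rw [Matrix.mul_assoc, hQt, ← Matrix.mul_assoc, hQQS]
  have hP' : P = (3 : R) • (Q * Q) - (2 : R) • (Q * Q * Q) := by
    rw [hP, ofNat_smul_eq_nsmul, ofNat_smul_eq_nsmul]
    noncomm_ring
    module
  have hSPt : (S * P)ᵀ = S * P := by
    rw [Matrix.transpose_mul, hS, hP']
    simp only [Matrix.transpose_sub, Matrix.transpose_smul, Matrix.transpose_mul, sub_mul, mul_sub,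
      Matrix.smul_mul, Matrix.mul_smul, hQQS, ← Matrix.mul_assoc, hQQQS]
  have hSPA : ∀ g, (A g)ᵀ * (S * P) * A g = S * P := by
    intro g
    have hc : Commute Q (A g) := hAQ g
    have hPc : Commute P (A g) := by
      rw [hP']
      exact ((hc.mul_left hc).smul_left _).sub_left (((hc.mul_left hc).mul_left hc).smul_left _)
    rw [Matrix.mul_assoc, Matrix.mul_assoc, hPc.eq, ← Matrix.mul_assoc, ← Matrix.mul_assoc, hA]
  have hU : S' * (P + p • (1 - P)) = S * (1 + p • ((1 - p) ^ 2 • Z)) := by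
    apply smul_right_injective _ hp0
    show p • _ = p • _
    rw [← Matrix.smul_mul, hpS', Matrix.mul_assoc, ← Matrix.mul_smul]
    congr 1
    have : (p • P + (1 - P)) * (P + p • (1 - P)) = p • 1 + (1 - p) ^ 2 • (P * (1 - P)) := by
      simp only [mul_add, add_mul, mul_sub, sub_mul, Matrix.smul_mul, Matrix.mul_smul, mul_one,
        one_mul, smul_sub]
      module
    rw [this, hZ]
    module
  have hdE := (aux_det_mod hp (1 + p • ((1 - p) ^ 2 • Z)) 1 _ rfl).2 (by simp)
  have hdU : ¬ IsUnit (P + p • (1 - P)).det := by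
    rw [aux_det_mod hp _ (T * S) ((1 - P) + Y * (1 - 2 * Q))]
    · rw [Matrix.det_mul]; exact fun h => hu (isUnit_of_mul_isUnit_right h)
    · have : P = Q + (Q * Q - Q) * (1 - 2 * Q) := by rw [hP]; noncomm_ring
      rw [← hQ]
      conv_lhs => enter [1]; rw [this, sub_eq_iff_eq_add'.2 hQQ]
      rw [smul_add, Matrix.smul_mul]; abel
  have hd := congrArg Matrix.det hU
  rw [Matrix.det_mul, Matrix.det_mul] at hd
  obtain ⟨v, hv⟩ := hdE.exists_right_inv
  have hd' : S.det = S'.det * ((P + p • (1 - P)).det * v) := by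
    rw [← mul_assoc, hd, mul_assoc, hv, mul_one]
  have hne : S'.det ≠ 0 := fun h => hdet (by rw [hd', h, zero_mul])
  refine ⟨S', ?_, ?_, hne, hne, _, fun h => hdU (isUnit_of_mul_isUnit_left h), hd'⟩
  · apply smul_right_injective _ hp0
    show p • _ = p • _
    rw [← Matrix.transpose_smul, hpS', mul_add, mul_sub, Matrix.mul_smul]
    simp only [Matrix.transpose_add, Matrix.transpose_sub, Matrix.transpose_smul, hSPt, mul_one, hS]
  · intro g
    apply smul_right_injective _ hp0
    show p • _ = p • _
    rw [← Matrix.smul_mul, ← Matrix.mul_smul, hpS', mul_add, mul_sub, Matrix.mul_smul, mul_one]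
    rw [mul_add, mul_sub, add_mul, sub_mul, hA, Matrix.mul_smul, Matrix.smul_mul, hSPA]

theorem aux_matrix [IsDomain R] [IsLocalRing R] [WfDvdMonoid R] {p : R} (hp0 : p ≠ 0)
    (hp : IsLocalRing.maximalIdeal R = Ideal.span {p})
    {G : Type*} [Group G] [Fintype G] (A : G →* Matrix n n R)
    (hG : IsUnit (Fintype.card G : R)) : ∀ (d : R)
    (S : Matrix n n R) (_ : S.det = d) (_ : Sᵀ = S) (_ : ∀ g, (A g)ᵀ * S * A g = S)
    (_ : S.det ≠ 0),
    ∃ S' : Matrix n n R, S'ᵀ = S' ∧ (∀ g, (A g)ᵀ * S' * A g = S') ∧ IsUnit S'.det := by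
  intro d
  induction d using (wellFounded_dvdNotUnit (α := R)).induction with
  | _ d ih =>
    intro S hd hS hA hne
    by_cases hu : IsUnit S.det
    · exact ⟨S, hS, hA, hu⟩
    · obtain ⟨S', h1, h2, h3, h4⟩ := aux_step hp0 hp A hG S hS hA hne hu
      exact ih _ (hd ▸ h4) S' rfl h1 h2 h3
end helpers

theorem exists_perfect_invariant_symmetric_form_on_lattice
    (ℓ : ℕ) [Fact (Nat.Prime ℓ)] (G : Type*) [Group G] [Fintype G]
    (hG : ¬ (ℓ ∣ Fintype.card G))
    (V : Type*) [AddCommGroup V] [Module ℚ_[ℓ] V] [FiniteDimensional ℚ_[ℓ] V]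
    [Module ℤ_[ℓ] V] [IsScalarTower ℤ_[ℓ] ℚ_[ℓ] V]
    (ρ : Representation ℚ_[ℓ] G V)
    (e : V →ₗ[ℚ_[ℓ]] V →ₗ[ℚ_[ℓ]] ℚ_[ℓ])
    (hsymm : ∀ x y : V, e x y = e y x)
    (hnd : ∀ x : V, (∀ y : V, e x y = 0) → x = 0)
    (hinv : ∀ (g : G) (x y : V), e (ρ g x) (ρ g y) = e x y)
    (M : Submodule ℤ_[ℓ] V) [Module.Finite ℤ_[ℓ] M] [Module.Free ℤ_[ℓ] M]
    (hspan : Submodule.span ℚ_[ℓ] (M : Set V) = ⊤)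
    (hstab : ∀ (g : G) (x : V), x ∈ M → ρ g x ∈ M) :
    ∃ e' : M →ₗ[ℤ_[ℓ]] M →ₗ[ℤ_[ℓ]] ℤ_[ℓ],
      (∀ x y : M, e' x y = e' y x) ∧
      (∀ (g : G) (x y : M),
        e' ⟨ρ g (x : V), hstab g x x.2⟩ ⟨ρ g (y : V), hstab g y y.2⟩ = e' x y) ∧
      Function.Bijective e' := by
  classical
  let b := Module.Free.chooseBasis ℤ_[ℓ] M
  -- the action on the lattice
  let r : G →* (M →ₗ[ℤ_[ℓ]] M) :=
    { toFun := fun g => ((ρ g).restrictScalars ℤ_[ℓ]).restrict (hstab g)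
      map_one' := by ext x; simp
      map_mul' := fun g h => by ext x; exact LinearMap.congr_fun (map_mul ρ g h) (x : V) }
  let A : G →* Matrix _ _ ℤ_[ℓ] :=
    (LinearMap.toMatrixAlgEquiv b).toMulEquiv.toMonoidHom.comp r
  -- integral multiple
  obtain ⟨c, hc⟩ := IsLocalization.exist_integer_multiples_of_finite (nonZeroDivisors ℤ_[ℓ])
    (fun ij : _ × _ => e (b ij.1) (b ij.2))
  have hc0 : (c : ℤ_[ℓ]) ≠ 0 := nonZeroDivisors.ne_zero c.2
  choose s hs using hc
  let S : Matrix _ _ ℤ_[ℓ] := Matrix.of fun i j => s (i, j)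
  let E : M →ₗ[ℤ_[ℓ]] M →ₗ[ℤ_[ℓ]] ℤ_[ℓ] := Matrix.toLinearMap₂ b b S
  have hE : ∀ x y : M, algebraMap ℤ_[ℓ] ℚ_[ℓ] (E x y) = algebraMap ℤ_[ℓ] ℚ_[ℓ] c * e x y := by
    intro x y
    have hx := b.sum_repr x
    have hy := b.sum_repr y
    have hx' : (x : V) = ∑ i, b.repr x i • (b i : V) := by
      have h := congrArg M.subtype hx
      rw [map_sum] at h
      exact h.symm
    have hy' : (y : V) = ∑ i, b.repr y i • (b i : V) := by
      have h := congrArg M.subtype hy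
      rw [map_sum] at h
      exact h.symm
    have hs' : ∀ i j, algebraMap ℤ_[ℓ] ℚ_[ℓ] (s (i, j)) = algebraMap ℤ_[ℓ] ℚ_[ℓ] c * e (b i) (b j) := by
      intro i j
      have := hs (i, j)
      rw [Algebra.smul_def] at this
      exact this
    have hsm : ∀ (r : ℤ_[ℓ]) (v : V), r • v = algebraMap ℤ_[ℓ] ℚ_[ℓ] r • v := fun r v =>
      (algebraMap_smul ℚ_[ℓ] r v).symm
    have hEx : E x y = ∑ i, ∑ j, b.repr x i * (b.repr y j * s (i, j)) :=
      Matrix.toLinearMap₂_apply b b S x y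
    rw [hEx, hx', hy']
    simp only [hsm, map_mul, map_sum, map_smul, LinearMap.sum_apply,
      LinearMap.smul_apply, smul_eq_mul, Finset.mul_sum, hs']
    rw [Finset.sum_comm]
    refine Finset.sum_congr rfl fun i _ => Finset.sum_congr rfl fun j _ => ?_
    ring
  have hinj : Function.Injective (algebraMap ℤ_[ℓ] ℚ_[ℓ]) := FaithfulSMul.algebraMap_injective _ _
  have hcQ : algebraMap ℤ_[ℓ] ℚ_[ℓ] c ≠ 0 := fun h => hc0 (hinj (h.trans (map_zero _).symm))
  have hSE : S = LinearMap.toMatrix₂ b b E := (LinearMap.toMatrix₂_toLinearMap₂ b b S).symm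
  have hSt : Sᵀ = S := by
    ext i j
    rw [Matrix.transpose_apply, hSE, LinearMap.toMatrix₂_apply, LinearMap.toMatrix₂_apply]
    apply hinj
    rw [hE, hE, hsymm]
  have hr : ∀ (g : G) (x : M), ((r g x : M) : V) = ρ g x := fun g x => rfl
  have hAr : ∀ g, A g = LinearMap.toMatrix b b (r g) := fun g => rfl
  have hSA : ∀ g, (A g)ᵀ * S * A g = S := by
    intro g
    rw [hSE, hAr, ← LinearMap.toMatrix₂_compl₁₂]
    congr 1
    refine LinearMap.ext₂ fun x y => ?_
    apply hinj
    rw [LinearMap.compl₁₂_apply, hE, hE, hr, hr, hinv]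
  have hdet : S.det ≠ 0 := by
    rw [hSE]
    apply LinearMap.separatingLeft_iff_det_ne_zero b |>.1
    intro x hx
    have h0 : ∀ y : V, e x y = 0 := by
      intro y
      have hy : y ∈ Submodule.span ℚ_[ℓ] (M : Set V) := hspan ▸ Submodule.mem_top
      induction hy using Submodule.span_induction with
      | mem y hy =>
        have h1 := hE x ⟨y, hy⟩
        rw [hx, map_zero] at h1
        exact (mul_eq_zero.1 h1.symm).resolve_left hcQ
      | zero => simp
      | add y z _ _ h1 h2 => rw [map_add, h1, h2, add_zero]
      | smul a y _ h1 => rw [map_smul, h1, smul_zero]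
    exact Subtype.ext (hnd _ h0)
  have hGu : IsUnit (Fintype.card G : ℤ_[ℓ]) := by
    by_contra h
    rw [PadicInt.not_isUnit_iff, PadicInt.norm_natCast_lt_one_iff] at h
    exact hG h
  obtain ⟨S', h1, h2, h3⟩ := aux_matrix (p := (ℓ : ℤ_[ℓ]))
    (by exact_mod_cast (Fact.out : Nat.Prime ℓ).ne_zero)
    PadicInt.maximalIdeal_eq_span_p A hGu _ S rfl hSt hSA hdet
  have hS'E : S' = LinearMap.toMatrix₂ b b (Matrix.toLinearMap₂ b b S') :=
    (LinearMap.toMatrix₂_toLinearMap₂ b b S').symm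
  refine ⟨Matrix.toLinearMap₂ b b S', ?_, ?_, ?_⟩
  · intro x y
    have : Matrix.toLinearMap₂ b b S' = (Matrix.toLinearMap₂ b b S').flip := by
      refine LinearMap.ext_basis b b fun i j => ?_
      rw [LinearMap.flip_apply, Matrix.toLinearMap₂_apply_basis, Matrix.toLinearMap₂_apply_basis]
      exact congrFun (congrFun h1.symm i) j
    exact LinearMap.congr_fun₂ this x y
  · intro g x y
    have h := h2 g
    rw [hAr, hS'E, ← LinearMap.toMatrix₂_compl₁₂] at h
    exact LinearMap.congr_fun₂ ((LinearMap.toMatrix₂ b b).injective h) x y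
  · have hm : LinearMap.toMatrix b b.dualBasis (Matrix.toLinearMap₂ b b S') = S' := by
      ext i j
      rw [LinearMap.toMatrix_apply, Module.Basis.dualBasis_repr, Matrix.toLinearMap₂_apply_basis]
      exact congrFun (congrFun h1 i) j
    exact (LinearEquiv.ofIsUnitDet (f := Matrix.toLinearMap₂ b b S') (v := b) (v' := b.dualBasis)
      (by rw [hm]; exact h3)).bijective
end

section
/- Let q be an odd prime and r a positive integer. If for all primes ℓ in a set of Dirichlet density 1 the group Sp_{2m}(𝔽_ℓ) contains an element of exact order q^r, then φ(q^r) ≤ 2m, where φ is Euler's totient function. -/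
open Filter Classical

attribute [local instance] Classical.propDecidable

namespace SympAux

open ArithmeticFunction ArithmeticFunction.vonMangoldt Complex LSeries in
/-- Upper bound for the sum of `Λ(n) n^{-x}` as `x → 1⁺`. -/
theorem vonMangoldt_upper :
    ∃ C : ℝ, ∀ x : ℝ, x ∈ Set.Ioc (1 : ℝ) 2 →
      ∑' n : ℕ, vonMangoldt n / (n : ℝ) ^ x ≤ 1 / (x - 1) + C := by
  let a : ZMod 1 := 0
  have ha : IsUnit a := isUnit_of_subsingleton a
  have hrc : ∀ n : ℕ, residueClass a n = vonMangoldt n := by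
    intro n
    apply Set.indicator_of_mem
    exact Subsingleton.elim _ _
  have H {x : ℝ} (hx : 1 < x) :
      ∑' n, residueClass a n / (n : ℝ) ^ x =
        (LFunctionResidueClassAux a x).re + ((1 : ℕ).totient : ℝ)⁻¹ / (x - 1) := by
    refine ofReal_injective ?_
    simp only [ofReal_tsum, ofReal_div, ofReal_cpow (Nat.cast_nonneg _), ofReal_natCast,
      ofReal_add, ofReal_inv, ofReal_sub, ofReal_one]
    simp_rw [← LFunctionResidueClassAux_real ha hx,
      eqOn_LFunctionResidueClassAux ha <| Set.mem_ofPred.mpr (ofReal_re x ▸ hx), sub_add_cancel,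
      LSeries, term]
    refine tsum_congr fun n ↦ ?_
    split_ifs with hn
    · simp only [hn, residueClass_apply_zero, ofReal_zero, zero_div]
    · rfl
  have : ContinuousOn (fun x : ℝ ↦ (LFunctionResidueClassAux a x).re) (Set.Icc 1 2) :=
    continuous_re.continuousOn.comp (t := Set.univ) (continuousOn_LFunctionResidueClassAux a)
      (fun ⦃x⦄ a ↦ trivial) |>.comp continuous_ofReal.continuousOn fun x hx ↦ by
        simpa only [Set.mem_ofPred_eq, ofReal_re] using hx.1
  obtain ⟨C, hC⟩ := bddAbove_def.mp <| IsCompact.bddAbove_image isCompact_Icc this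
  refine ⟨C, fun x hx ↦ ?_⟩
  have h1 := hC (LFunctionResidueClassAux a x).re <|
      Set.mem_image_of_mem (fun x : ℝ ↦ (LFunctionResidueClassAux a x).re)
        (Set.mem_Icc_of_Ioc hx)
  have h2 := H hx.1
  simp only [hrc] at h2
  rw [h2]
  simp only [Nat.totient_one, Nat.cast_one, inv_one]
  linarith

open ArithmeticFunction ArithmeticFunction.vonMangoldt in
theorem summable_rc {Q : ℕ} (a : ZMod Q) {x : ℝ} (hx : 1 < x) :
    Summable fun n : ℕ => residueClass a n / (n : ℝ) ^ x :=
  LSeries.summable_real_of_abscissaOfAbsConv_lt <|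
        (abscissaOfAbsConv_residueClass_le_one a).trans_lt <| mod_cast hx

open ArithmeticFunction ArithmeticFunction.vonMangoldt in
theorem summable_vM {x : ℝ} (hx : 1 < x) :
    Summable fun n : ℕ => vonMangoldt n / (n : ℝ) ^ x := by
  have hrc : ∀ n : ℕ, residueClass (0 : ZMod 1) n = vonMangoldt n := by
    intro n
    apply Set.indicator_of_mem
    exact Subsingleton.elim _ _
  have := summable_rc (0 : ZMod 1) hx
  simpa only [hrc] using this

/-- Abel summation inequality. -/
theorem abel (a f : ℕ → ℝ) (K : ℝ) (hf : ∀ n, f (n + 1) ≤ f n) (hf0 : ∀ n, 0 ≤ f n)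
    (hT : ∀ N, ∑ n ∈ Finset.range N, a n ≤ K) (N : ℕ) :
    ∑ n ∈ Finset.range N, a n * f n ≤ K * f 0 := by
  have key : ∀ N, ∑ n ∈ Finset.range N, a n * f n
      ≤ K * f 0 + (∑ n ∈ Finset.range N, a n - K) * f N := by
    intro N
    induction N with
    | zero => simp
    | succ N ih =>
      have h := hT (N + 1)
      rw [Finset.sum_range_succ] at h
      rw [Finset.sum_range_succ, Finset.sum_range_succ]
      nlinarith [hf N]
  nlinarith [key N, hT N, hf0 N]

open ArithmeticFunction ArithmeticFunction.vonMangoldt in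
theorem not_density_zero {Q : ℕ} [NeZero Q] {a : ZMod Q} (ha : IsUnit a)
    (h : ∀ ε : ℝ, 0 < ε → ∃ N₀ : ℕ, ∀ N ≥ N₀,
      (((Finset.range N).filter fun p : ℕ => p.Prime ∧ (p : ZMod Q) = a).card : ℝ) ≤
        ε * (((Finset.range N).filter Nat.Prime).card : ℝ)) : False := by
  have hφ : (0 : ℝ) < (Q.totient : ℝ)⁻¹ := inv_pos.mpr (mod_cast Q.totient.pos_of_neZero)
  set c : ℝ := (Q.totient : ℝ)⁻¹ with hc
  obtain ⟨C₁, hC₁⟩ := LSeries_residueClass_lower_bound ha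
  obtain ⟨C₂, hC₂⟩ := vonMangoldt_upper
  obtain ⟨N₁, hN₁⟩ := h (c / 2) (by positivity)
  set ε : ℝ := c / 2 with hε
  have hε0 : 0 < ε := by positivity
  set N₀ := max N₁ 3 with hN₀
  have h3 : 3 ≤ N₀ := le_max_right _ _
  let iA : ℕ → ℝ := fun n => if n.Prime ∧ (n : ZMod Q) = a then 1 else 0
  let iP : ℕ → ℝ := fun n => if n.Prime then 1 else 0
  have hA : ∀ N ≥ N₀, ∑ n ∈ Finset.range N, (iA n - ε * iP n) ≤ 0 := by
    intro N hN
    have := hN₁ N (le_trans (le_max_left _ _) hN)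
    rw [Finset.sum_sub_distrib, ← Finset.mul_sum]
    simp only [iA, iP, Finset.sum_boole]
    linarith
  set K : ℝ := |∑ n ∈ Finset.range N₀, (iA n - ε * iP n)| with hK
  have hK0 : 0 ≤ K := abs_nonneg _
  let nonp : ℕ → ℝ := fun n => (if n.Prime then 0 else residueClass a n) / n
  have hnonp : Summable nonp := summable_residueClass_non_primes_div a
  have hnonp0 : ∀ n, 0 ≤ nonp n := by
    intro n
    have := residueClass_nonneg a n
    simp only [nonp]
    split_ifs <;> positivity
  set D₁ : ℝ := ∑ n ∈ Finset.range N₀, residueClass a n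
  set D₂ : ℝ := ∑' n, nonp n
  have main : ∀ x ∈ Set.Ioc (1 : ℝ) 2, ∑' n, residueClass a n / (n : ℝ) ^ x ≤
      D₁ + (D₂ + (K * Real.log N₀ + ε * ∑' n : ℕ, vonMangoldt n / (n : ℝ) ^ x)) := by
    intro x hx
    have hx0 : 0 < x := by linarith [hx.1]
    let f : ℕ → ℝ := fun n => Real.log n / (n : ℝ) ^ x
    have hf0 : ∀ n, 0 ≤ f n := fun n => div_nonneg (Real.log_natCast_nonneg n) (by positivity)
    have hpow : ∀ n : ℕ, 1 ≤ n → (n : ℝ) ≤ (n : ℝ) ^ x := by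
      intro n hn
      conv_lhs => rw [← Real.rpow_one n]
      exact Real.rpow_le_rpow_of_exponent_le (by exact_mod_cast hn) hx.1.le
    have hanti : ∀ n : ℕ, f (N₀ + (n + 1)) ≤ f (N₀ + n) := by
      intro n
      have he : Real.exp x⁻¹ ≤ 3 := by
        calc Real.exp x⁻¹ ≤ Real.exp 1 :=
              Real.exp_le_exp.mpr (inv_le_one_of_one_le₀ hx.1.le)
          _ ≤ 3 := by linarith [Real.exp_one_lt_d9]
      have h3' : (3 : ℝ) ≤ N₀ := by exact_mod_cast h3
      refine Real.log_div_self_rpow_antitoneOn hx0 ?_ ?_ ?_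
      · simp only [Set.mem_Ici]; push_cast; linarith [(Nat.cast_nonneg n : (0 : ℝ) ≤ n)]
      · simp only [Set.mem_Ici]; push_cast; linarith [(Nat.cast_nonneg n : (0 : ℝ) ≤ n)]
      · push_cast; linarith
    have hab : ∀ N, ∑ n ∈ Finset.range N, (iA (N₀ + n) - ε * iP (N₀ + n)) * f (N₀ + n)
        ≤ K * f N₀ := by
      intro N
      refine abel (fun n => iA (N₀ + n) - ε * iP (N₀ + n)) (fun n => f (N₀ + n)) K hanti
        (fun n => hf0 _) ?_ N
      intro M
      have h1 := hA (N₀ + M) (Nat.le_add_right _ _)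
      rw [Finset.sum_range_add] at h1
      have h2 := neg_abs_le (∑ n ∈ Finset.range N₀, (iA n - ε * iP n))
      simp only [← hK] at h2
      linarith
    have hfN : f N₀ ≤ Real.log N₀ := by
      refine div_le_self (Real.log_natCast_nonneg _) ?_
      exact le_trans (by exact_mod_cast (by omega : 1 ≤ N₀)) (hpow N₀ (by omega))
    have hvM0 : ∀ n : ℕ, 0 ≤ vonMangoldt n / (n : ℝ) ^ x := fun n =>
      div_nonneg vonMangoldt_nonneg (by positivity)
    have hP : ∀ N, ∑ n ∈ Finset.range N, iP (N₀ + n) * f (N₀ + n) ≤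
        ∑' n : ℕ, vonMangoldt n / (n : ℝ) ^ x := by
      intro N
      calc _ ≤ ∑ n ∈ Finset.range N, vonMangoldt (N₀ + n) / ((N₀ + n : ℕ) : ℝ) ^ x := by
            refine Finset.sum_le_sum fun n _ => ?_
            simp only [iP]
            split_ifs with hp
            · rw [one_mul, vonMangoldt_apply_prime hp]
            · rw [zero_mul]; exact hvM0 _
        _ ≤ ∑ n ∈ Finset.range (N₀ + N), vonMangoldt n / (n : ℝ) ^ x := by
            rw [Finset.sum_range_add]
            exact le_add_of_nonneg_left (Finset.sum_nonneg fun n _ => hvM0 n)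
        _ ≤ _ := (summable_vM hx.1).sum_le_tsum _ (fun n _ => hvM0 n)
    have hrc0 : ∀ n : ℕ, 0 ≤ residueClass a n / (n : ℝ) ^ x := fun n =>
      div_nonneg (residueClass_nonneg a n) (by positivity)
    refine Real.tsum_le_of_sum_range_le hrc0 fun N => ?_
    have s0 : ∑ n ∈ Finset.range N, residueClass a n / (n : ℝ) ^ x ≤
        ∑ n ∈ Finset.range (N₀ + N), residueClass a n / (n : ℝ) ^ x :=
      Finset.sum_le_sum_of_subset_of_nonneg
        (Finset.range_mono (Nat.le_add_left _ _)) (fun n _ _ => hrc0 n)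
    rw [Finset.sum_range_add] at s0
    have s1 : ∑ n ∈ Finset.range N₀, residueClass a n / (n : ℝ) ^ x ≤ D₁ := by
      refine Finset.sum_le_sum fun n _ => ?_
      rcases Nat.eq_zero_or_pos n with rfl | hn
      · simp
      · refine div_le_self (residueClass_nonneg a n) ?_
        exact le_trans (by exact_mod_cast hn) (hpow n hn)
    have s2 : ∑ n ∈ Finset.range N, residueClass a (N₀ + n) / ((N₀ + n : ℕ) : ℝ) ^ x ≤
        ∑ n ∈ Finset.range N, nonp (N₀ + n) +
          ∑ n ∈ Finset.range N, iA (N₀ + n) * f (N₀ + n) := by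
      rw [← Finset.sum_add_distrib]
      refine Finset.sum_le_sum fun n _ => ?_
      have hpos : 1 ≤ N₀ + n := by omega
      generalize N₀ + n = k at hpos ⊢
      have hk : (0 : ℝ) < k := by exact_mod_cast hpos
      by_cases hp : k.Prime
      · by_cases hka : (k : ZMod Q) = a
        · have : residueClass a k = Real.log k := by
            rw [← vonMangoldt_apply_prime hp]
            exact Set.indicator_of_mem (s := {n : ℕ | (n : ZMod Q) = a}) hka _
          rw [this]
          simp [nonp, iA, hp, hka, f]
        · have : residueClass a k = 0 := Set.indicator_of_notMem (s := {n : ℕ | (n : ZMod Q) = a}) hka _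
          rw [this]
          simp [nonp, iA, hp, hka]
      · simp only [nonp, iA, hp, if_false, false_and, zero_mul, add_zero]
        exact div_le_div_of_nonneg_left (residueClass_nonneg a k) hk (hpow k hpos)
    have s3 : ∑ n ∈ Finset.range N, nonp (N₀ + n) ≤ D₂ := by
      refine le_trans ?_ (hnonp.sum_le_tsum (Finset.range (N₀ + N)) (fun n _ => hnonp0 n))
      rw [Finset.sum_range_add]
      exact le_add_of_nonneg_left (Finset.sum_nonneg fun n _ => hnonp0 n)
    have s4 := hab N
    simp only [sub_mul, Finset.sum_sub_distrib, mul_assoc, ← Finset.mul_sum] at s4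
    have s5 := mul_le_mul_of_nonneg_left (hP N) hε0.le
    have s6 := mul_le_mul_of_nonneg_left hfN hK0
    linarith
  set E : ℝ := D₁ + D₂ + K * Real.log N₀ + ε * C₂ + C₁ with hE
  have fin : ∀ x ∈ Set.Ioc (1 : ℝ) 2, ε / (x - 1) ≤ E := by
    intro x hx
    have h1 := hC₁ hx
    have h2 := main x hx
    have h3 := mul_le_mul_of_nonneg_left (hC₂ x hx) hε0.le
    have h4 : c / (x - 1) = ε / (x - 1) + ε * (1 / (x - 1)) := by rw [hε]; ring
    rw [← hc, h4] at h1
    rw [hE]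
    nlinarith
  have hEpos : 0 < E := by
    have := fin 2 ⟨by norm_num, le_refl _⟩
    norm_num at this
    linarith
  have hmin : 0 < min 1 (ε / (2 * E)) := lt_min one_pos (by positivity)
  have := fin (1 + min 1 (ε / (2 * E))) ⟨by linarith, by linarith [min_le_left 1 (ε / (2 * E))]⟩
  rw [add_sub_cancel_left, div_le_iff₀ hmin] at this
  have h5 : E * min 1 (ε / (2 * E)) ≤ E * (ε / (2 * E)) :=
    mul_le_mul_of_nonneg_left (min_le_right _ _) hEpos.le
  have h6 : E * (ε / (2 * E)) = ε / 2 := by field_simp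
  linarith

open Polynomial in
theorem totient_le_of_matrix {q r ℓ : ℕ} (hq : q.Prime) (hr : 0 < r) [hℓ : Fact ℓ.Prime]
    (u : (ZMod (q ^ r))ˣ) (hu : orderOf u = Nat.totient (q ^ r))
    (hlu : (ℓ : ZMod (q ^ r)) = u) {ι : Type} [Fintype ι] [DecidableEq ι]
    (M : Matrix ι ι (ZMod ℓ)) (hM : orderOf M = q ^ r) :
    Nat.totient (q ^ r) ≤ Fintype.card ι := by
  obtain ⟨k, rfl⟩ : ∃ k, r = k + 1 := ⟨r - 1, by omega⟩
  have : Fact q.Prime := ⟨hq⟩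
  have hcop : ℓ.Coprime (q ^ (k + 1)) := by
    rw [← ZMod.isUnit_iff_coprime, hlu]
    exact u.isUnit
  have hdvd : minpoly (ZMod ℓ) M ∣ cyclotomic (q ^ (k + 1)) (ZMod ℓ) * (X ^ q ^ k - 1) := by
    rw [cyclotomic_prime_pow_mul_X_pow_sub_one]
    apply minpoly.dvd
    simp [← hM, pow_orderOf_eq_one]
  have hnc : ¬ IsCoprime (minpoly (ZMod ℓ) M) (cyclotomic (q ^ (k + 1)) (ZMod ℓ)) := by
    intro hco
    have h1 := hco.dvd_of_dvd_mul_left hdvd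
    have h2 : aeval M (X ^ q ^ k - 1 : (ZMod ℓ)[X]) = 0 := by
      obtain ⟨c, hc⟩ := h1
      rw [hc, map_mul, minpoly.aeval, zero_mul]
    have h3 : M ^ q ^ k = 1 := by
      simpa [sub_eq_zero] using h2
    have h4 := orderOf_dvd_of_pow_eq_one h3
    rw [hM] at h4
    have := (Nat.pow_dvd_pow_iff_le_right hq.one_lt).mp h4
    omega
  have hint : IsIntegral (ZMod ℓ) M := Algebra.IsIntegral.isIntegral M
  have hm0 : minpoly (ZMod ℓ) M ≠ 0 := minpoly.ne_zero hint
  have : ∃ P : (ZMod ℓ)[X], Irreducible P ∧ P ∣ minpoly (ZMod ℓ) M ∧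
      P ∣ cyclotomic (q ^ (k + 1)) (ZMod ℓ) := by
    by_contra hcon
    push Not at hcon
    exact hnc (isCoprime_of_irreducible_dvd (fun hh => hm0 hh.1) fun P hP h1 h2 => hcon P hP h1 h2)
  obtain ⟨P, hP, hP1, hP2⟩ := this
  have hdeg := natDegree_of_dvd_cyclotomic_of_irreducible (K := ZMod ℓ) (f := 1) (p := ℓ)
    (by simp) hcop hP2 hP
  have hun : ZMod.unitOfCoprime _ (hcop.pow_left 1) = u := by
    ext
    simp [hlu]
  rw [hun, hu] at hdeg
  rw [← hdeg, ← Matrix.charpoly_natDegree_eq_dim M]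
  exact natDegree_le_of_dvd (hP1.trans (Matrix.minpoly_dvd_charpoly M))
    (Matrix.charpoly_monic M).ne_zero

end SympAux

/-- Proposition: if `q` is an odd prime, `r, m` are positive, and for all primes `ℓ` in a set
of density 1 the group `Sp_{2m}(𝔽_ℓ)` contains an element of exact order `q^r`, then
`φ(q^r) ≤ 2m`. -/
theorem totient_le_of_density_one_symplectic_order (q : ℕ) (hq : q.Prime) (hq2 : q ≠ 2)
    (r m : ℕ) (hr : 0 < r) (hm : 0 < m)
    (hdens : Tendsto
      (fun N : ℕ =>
        (((Finset.range N).filter fun ℓ => ℓ.Prime ∧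
            ∃ g : Matrix.symplecticGroup (Fin m) (ZMod ℓ), orderOf g = q ^ r).card : ℝ) /
        (((Finset.range N).filter Nat.Prime).card : ℝ))
      atTop (nhds 1)) :
    Nat.totient (q ^ r) ≤ 2 * m := by
  by_contra hlt
  have hQ : NeZero (q ^ r) := ⟨(pow_pos hq.pos r).ne'⟩
  have := ZMod.isCyclic_units_of_prime_pow q hq hq2 r
  obtain ⟨u, hu⟩ := IsCyclic.exists_ofOrder_eq_natCard (α := (ZMod (q ^ r))ˣ)
  rw [Nat.card_eq_fintype_card, ZMod.card_units_eq_totient] at hu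
  have hdisj : ∀ ℓ : ℕ, ℓ.Prime → (ℓ : ZMod (q ^ r)) = u →
      ¬ ∃ g : Matrix.symplecticGroup (Fin m) (ZMod ℓ), orderOf g = q ^ r := by
    rintro ℓ hℓ hlu ⟨g, hg⟩
    have : Fact ℓ.Prime := ⟨hℓ⟩
    apply hlt
    have hM : orderOf (g : Matrix (Fin m ⊕ Fin m) (Fin m ⊕ Fin m) (ZMod ℓ)) = q ^ r := by
      rw [orderOf_submonoid, hg]
    have := SympAux.totient_le_of_matrix hq hr u hu hlu _ hM
    simpa [two_mul] using this
  refine SympAux.not_density_zero (Q := q ^ r) u.isUnit fun ε hε => ?_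
  obtain ⟨N₀, hN₀⟩ := eventually_atTop.mp
    (hdens.eventually (lt_mem_nhds (by linarith : 1 - ε < 1)))
  refine ⟨max N₀ 3, fun N hN => ?_⟩
  have h1 := hN₀ N (le_trans (le_max_left _ _) hN)
  have hpos : (0 : ℝ) < (((Finset.range N).filter Nat.Prime).card : ℝ) := by
    have h2 : 2 ∈ (Finset.range N).filter Nat.Prime := by
      simp only [Finset.mem_filter, Finset.mem_range]
      exact ⟨by have := le_trans (le_max_right N₀ 3) hN; omega, Nat.prime_two⟩
    exact_mod_cast Finset.card_pos.mpr ⟨2, h2⟩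
  rw [lt_div_iff₀ hpos] at h1
  have h2 : ((Finset.range N).filter fun p : ℕ => p.Prime ∧ (p : ZMod (q ^ r)) = u).card +
      ((Finset.range N).filter fun ℓ => ℓ.Prime ∧
        ∃ g : Matrix.symplecticGroup (Fin m) (ZMod ℓ), orderOf g = q ^ r).card ≤
      ((Finset.range N).filter Nat.Prime).card := by
    rw [← Finset.card_union_of_disjoint]
    · apply Finset.card_le_card
      intro p hp
      simp only [Finset.mem_union, Finset.mem_filter] at hp ⊢
      rcases hp with hp | hp
      · exact ⟨hp.1, hp.2.1⟩
      · exact ⟨hp.1, hp.2.1⟩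
    · rw [Finset.disjoint_left]
      intro p hp hp'
      simp only [Finset.mem_filter] at hp hp'
      exact hdisj p hp.2.1 hp.2.2 hp'.2.2
  have h3 : (((Finset.range N).filter fun p : ℕ => p.Prime ∧ (p : ZMod (q ^ r)) = u).card : ℝ) +
      (((Finset.range N).filter fun ℓ => ℓ.Prime ∧
        ∃ g : Matrix.symplecticGroup (Fin m) (ZMod ℓ), orderOf g = q ^ r).card : ℝ) ≤
      (((Finset.range N).filter Nat.Prime).card : ℝ) := by
    exact_mod_cast h2
  have h4 : (((Finset.range N).filter fun p : ℕ => p.Prime ∧ (p : ZMod (q ^ r)) = u).card : ℝ) ≤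
      ε * (((Finset.range N).filter Nat.Prime).card : ℝ) := by
    linarith
  convert h4
end
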